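/- Pohozaev identity on an annulus: Let 0 < δ < 1, let K be C¹ on the annulus D \ D̄_δ, and let u solve −Δu = K e^{2u} on D \ D̄_δ. Define, for δ < t < 1, P(t) = t ∫_{∂D_t} ( |∂u/∂r|² − r^{−2} |∂u/∂θ|² ) dσ + 2 ∫_{∂D_t} (∂u/∂r) dσ + t ∫_{∂D_t} K e^{2u} dσ, where (r,θ) are polar coordinates centered at 0. Then for every δ < s < t < 1, P(t) − P(s) = ∫_{D_t \ D_s} r e^{2u} (∂K/∂r) dx. -/

import Mathlib

open MeasureTheory Filter Topology

noncomputable section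

/-- The Euclidean Laplacian of a function on `ℂ ≅ ℝ²` (sum of the second derivatives
in the directions `1` and `i`). -/
def lapC (u : ℂ → ℝ) (z : ℂ) : ℝ :=
  iteratedFDeriv ℝ 2 u z ![1, 1] + iteratedFDeriv ℝ 2 u z ![Complex.I, Complex.I]

/-- The circle integral `∫_{∂D_t} f dσ` (with respect to arclength measure),
parametrized by the angle. -/
def circleIntegral' (t : ℝ) (f : ℂ → ℝ) : ℝ :=
  t * ∫ θ in (0:ℝ)..(2 * Real.pi), f ((t : ℂ) * Complex.exp (θ * Complex.I))

/-- The radial derivative `∂u/∂r` at `z = t e^{iθ}` (here evaluated via the unit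
radial direction `e^{iθ}`). -/
def radialDeriv (u : ℂ → ℝ) (z : ℂ) : ℝ := fderiv ℝ u z (‖z‖⁻¹ • z)

/-- The angular derivative `∂u/∂θ` at `z` (derivative along the parametrization
`θ ↦ t e^{iθ}`, i.e. in the direction `iz`). -/
def angularDeriv (u : ℂ → ℝ) (z : ℂ) : ℝ := fderiv ℝ u z (Complex.I * z)

/-- The Pohozaev boundary functional
`P(t) = t ∫_{∂D_t} (|∂u/∂r|² − r^{-2} |∂u/∂θ|²) dσ + 2 ∫_{∂D_t} ∂u/∂r dσ
  + t ∫_{∂D_t} K e^{2u} dσ`. -/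
def pohP (u K : ℂ → ℝ) (t : ℝ) : ℝ :=
  t * circleIntegral' t (fun z => (radialDeriv u z) ^ 2 - (angularDeriv u z) ^ 2 / ‖z‖ ^ 2) +
  2 * circleIntegral' t (fun z => radialDeriv u z) +
  t * circleIntegral' t (fun z => K z * Real.exp (2 * u z))

theorem continuous_polar : Continuous fun p : ℝ × ℝ => (p.1 : ℂ) * Complex.exp (p.2 * Complex.I) := by
  fun_prop

theorem norm_polar {r : ℝ} (hr : 0 ≤ r) (θ : ℝ) : ‖(r : ℂ) * Complex.exp (θ * Complex.I)‖ = r := by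
  rw [norm_mul, Complex.norm_exp_ofReal_mul_I, mul_one, Complex.norm_real, Real.norm_of_nonneg hr]

theorem hasDerivAt_polar_radial (r θ : ℝ) :
    HasDerivAt (fun r : ℝ => (r : ℂ) * Complex.exp (θ * Complex.I))
      (Complex.exp (θ * Complex.I)) r := by
  simpa using (Complex.ofRealCLM.hasDerivAt (x := r)).mul_const (Complex.exp (θ * Complex.I))

theorem hasDerivAt_polar_angular (r θ : ℝ) :
    HasDerivAt (fun θ : ℝ => (r : ℂ) * Complex.exp (θ * Complex.I))
      (Complex.I * ((r : ℂ) * Complex.exp (θ * Complex.I))) θ := by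
  have h := ((((Complex.ofRealCLM.hasDerivAt (x := θ)).mul_const Complex.I).cexp).const_mul (r : ℂ))
  refine h.congr_deriv ?_
  simp only [Complex.ofRealCLM_apply, Complex.ofReal_one]
  ring

theorem periodic_polar (f : ℂ → ℝ) (r : ℝ) :
    Function.Periodic (fun θ : ℝ => f ((r : ℂ) * Complex.exp (θ * Complex.I)))
      (2 * Real.pi) := by
  intro θ
  simp [add_mul, Complex.exp_add]

/-- Integration over an annulus in polar coordinates. -/
theorem setIntegral_annulus_eq {s t : ℝ} (hs : 0 ≤ s) (hst : s ≤ t) {f : ℂ → ℝ}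
    (hf : ContinuousOn f {z | ‖z‖ ∈ Set.Icc s t}) :
    ∫ z in Metric.ball (0:ℂ) t \ Metric.closedBall (0:ℂ) s, f z =
      ∫ r in s..t, r * ∫ θ in (0:ℝ)..(2 * Real.pi),
        f ((r : ℂ) * Complex.exp (θ * Complex.I)) := by
  have hpi : -Real.pi ≤ Real.pi := by linarith [Real.pi_pos]
  have hcont : ContinuousOn (fun p : ℝ × ℝ => p.1 * f ((p.1 : ℂ) * Complex.exp (p.2 * Complex.I)))
      (Set.Icc s t ×ˢ Set.Icc (-Real.pi) Real.pi) := by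
    refine continuousOn_fst.mul (hf.comp continuous_polar.continuousOn ?_)
    rintro ⟨r, θ⟩ ⟨hr, -⟩
    simpa only [Set.mem_ofPred_eq, norm_polar (hs.trans hr.1)] using hr
  have hint := hcont.integrableOn_compact (μ := volume) (isCompact_Icc.prod isCompact_Icc)
  rw [← integral_indicator (measurableSet_ball.diff measurableSet_closedBall),
    ← Complex.integral_comp_polarCoord_symm]
  have h1 : ∀ p ∈ polarCoord.target, p.1 • (Metric.ball (0:ℂ) t \ Metric.closedBall (0:ℂ) s).indicator
      f (Complex.polarCoord.symm p) = (Set.Ioo s t ×ˢ Set.univ).indicator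
        (fun p : ℝ × ℝ => p.1 * f ((p.1 : ℂ) * Complex.exp (p.2 * Complex.I))) p := by
    rintro ⟨r, θ⟩ hp
    have hr : 0 < r := hp.1
    have he : Complex.polarCoord.symm (r, θ) = (r : ℂ) * Complex.exp (θ * Complex.I) := by
      simp [Complex.exp_mul_I]
    have hm : (r : ℂ) * Complex.exp (θ * Complex.I) ∈
        Metric.ball (0:ℂ) t \ Metric.closedBall (0:ℂ) s ↔ (r, θ) ∈ Set.Ioo s t ×ˢ Set.univ := by
      simp only [Set.mem_sdiff, mem_ball_zero_iff, mem_closedBall_zero_iff, norm_polar hr.le,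
        Set.mem_prod, Set.mem_Ioo, Set.mem_univ, and_true, not_le]
      tauto
    rw [he]
    by_cases h : (r, θ) ∈ Set.Ioo s t ×ˢ (Set.univ : Set ℝ)
    · rw [Set.indicator_of_mem h, Set.indicator_of_mem (hm.2 h), smul_eq_mul]
    · rw [Set.indicator_of_notMem h, Set.indicator_of_notMem (mt hm.1 h), smul_zero]
  rw [setIntegral_congr_fun polarCoord.open_target.measurableSet h1,
    setIntegral_indicator (measurableSet_Ioo.prod MeasurableSet.univ)]
  have hset : polarCoord.target ∩ Set.Ioo s t ×ˢ Set.univ =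
      Set.Ioo s t ×ˢ Set.Ioo (-Real.pi) Real.pi := by
    ext ⟨r, θ⟩
    simp only [polarCoord_target, Set.mem_inter_iff, Set.mem_prod, Set.mem_Ioi, Set.mem_Ioo,
      Set.mem_univ, and_true]
    constructor
    · tauto
    · rintro ⟨h, h'⟩
      exact ⟨⟨hs.trans_lt h.1, h'⟩, h⟩
  rw [hset, Measure.volume_eq_prod, setIntegral_prod, intervalIntegral.integral_of_le hst,
    integral_Ioc_eq_integral_Ioo]
  · refine setIntegral_congr_fun measurableSet_Ioo fun r _ => ?_
    simp only
    rw [integral_const_mul]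
    congr 1
    have := (periodic_polar f r).intervalIntegral_add_eq 0 (-Real.pi)
    rw [zero_add, show -Real.pi + 2 * Real.pi = Real.pi by ring] at this
    rw [this, intervalIntegral.integral_of_le hpi, integral_Ioc_eq_integral_Ioo]
  · exact hint.mono_set (Set.prod_mono Set.Ioo_subset_Icc_self Set.Ioo_subset_Icc_self)

/-- The angular derivative of a `C¹` function integrates to zero over a circle. -/
theorem integral_angularDeriv_eq_zero {U : Set ℂ} (hU : IsOpen U) {G : ℂ → ℝ}
    (hG : ContDiffOn ℝ 1 G U) {r : ℝ}
    (hr : ∀ θ : ℝ, (r : ℂ) * Complex.exp (θ * Complex.I) ∈ U) :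
    ∫ θ in (0:ℝ)..(2 * Real.pi), angularDeriv G ((r : ℂ) * Complex.exp (θ * Complex.I)) = 0 := by
  have hc : Continuous fun θ : ℝ => (r : ℂ) * Complex.exp (θ * Complex.I) := by fun_prop
  rw [intervalIntegral.integral_eq_sub_of_hasDerivAt
    (f := fun θ : ℝ => G ((r : ℂ) * Complex.exp (θ * Complex.I)))]
  · have := periodic_polar G r 0
    rw [zero_add] at this
    exact sub_eq_zero.2 this
  · intro θ _
    exact ((hG.differentiableOn one_ne_zero).differentiableAt
      (hU.mem_nhds (hr θ))).hasFDerivAt.comp_hasDerivAt θ (hasDerivAt_polar_angular r θ)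
  · refine Continuous.intervalIntegrable ?_ _ _
    exact ((hG.continuousOn_fderiv_of_isOpen hU le_rfl).comp_continuous hc hr).clm_apply
      (continuous_const.mul hc)

theorem hasFDerivAt_fderiv_apply {u : ℂ → ℝ} {z : ℂ} (hu : ContDiffAt ℝ 2 u z) (L : ℂ →L[ℝ] ℂ) :
    HasFDerivAt (fun z => fderiv ℝ u z (L z))
      ((fderiv ℝ u z).comp L + (fderiv ℝ (fderiv ℝ u) z).flip (L z)) z :=
  ((hu.fderiv_right (m := 1) (by norm_num)).differentiableAt one_ne_zero).hasFDerivAt.clm_apply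
    L.hasFDerivAt

/-- The Laplacian computed in the orthogonal frame `z`, `I * z`. -/
theorem fderiv_fderiv_radial_add_angular (u : ℂ → ℝ) (z : ℂ) :
    fderiv ℝ (fderiv ℝ u) z z z + fderiv ℝ (fderiv ℝ u) z (Complex.I * z) (Complex.I * z) =
      ‖z‖ ^ 2 * lapC u z := by
  have h1 : z = z.re • (1 : ℂ) + z.im • Complex.I := by
    simp [Complex.re_add_im]
  have h2 : Complex.I * z = (-z.im) • (1 : ℂ) + z.re • Complex.I := by
    apply Complex.ext <;> simp
  rw [lapC, iteratedFDeriv_two_apply, iteratedFDeriv_two_apply, h2]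
  generalize fderiv ℝ (fderiv ℝ u) z = B
  have h3 : B z z = B (z.re • (1 : ℂ) + z.im • Complex.I) (z.re • (1 : ℂ) + z.im • Complex.I) := by
    rw [← h1]
  rw [h3, ← Complex.normSq_eq_norm_sq, Complex.normSq_apply]
  simp only [map_add, map_smul, add_apply, smul_apply,
    smul_eq_mul, Matrix.cons_val_zero, Matrix.cons_val_one]
  ring

/-- The density on the circle of radius `r` whose angular integral is `pohP u K r`. -/
def pohDensity (u K : ℂ → ℝ) (r : ℝ) (z : ℂ) : ℝ :=
  fderiv ℝ u z z ^ 2 - fderiv ℝ u z (Complex.I * z) ^ 2 + 2 * fderiv ℝ u z z +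
    r ^ 2 * (K z * Real.exp (2 * u z))

/-- The function whose angular derivative is the divergence term in the radial derivative of
`pohDensity`. -/
def pohFlux (u : ℂ → ℝ) (z : ℂ) : ℝ :=
  fderiv ℝ u z z * fderiv ℝ u z (Complex.I * z) + fderiv ℝ u z (Complex.I * z)

theorem contDiffOn_pohFlux {U : Set ℂ} (hU : IsOpen U) {u : ℂ → ℝ} (hu : ContDiffOn ℝ 2 u U) :
    ContDiffOn ℝ 1 (pohFlux u) U := by
  have h := hu.fderiv_of_isOpen hU (m := 1) (by norm_num)
  have hI : ContDiffOn ℝ 1 (fun z => fderiv ℝ u z (Complex.I * z)) U :=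
    h.clm_apply (contDiffOn_const.mul contDiffOn_id)
  exact ((h.clm_apply contDiffOn_id).mul hI).add hI

theorem hasDerivAt_pohDensity {u K : ℂ → ℝ} {r θ : ℝ} (hr : 0 < r)
    (hu : ContDiffAt ℝ 2 u ((r : ℂ) * Complex.exp (θ * Complex.I)))
    (hK : DifferentiableAt ℝ K ((r : ℂ) * Complex.exp (θ * Complex.I)))
    (heq : -lapC u ((r : ℂ) * Complex.exp (θ * Complex.I)) =
      K ((r : ℂ) * Complex.exp (θ * Complex.I)) *
        Real.exp (2 * u ((r : ℂ) * Complex.exp (θ * Complex.I)))) :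
    HasDerivAt (fun r : ℝ => pohDensity u K r ((r : ℂ) * Complex.exp (θ * Complex.I)))
      (r * (Real.exp (2 * u ((r : ℂ) * Complex.exp (θ * Complex.I))) *
          fderiv ℝ K ((r : ℂ) * Complex.exp (θ * Complex.I))
            ((r : ℂ) * Complex.exp (θ * Complex.I))) -
        2 / r * angularDeriv (pohFlux u) ((r : ℂ) * Complex.exp (θ * Complex.I))) r := by
  have hγ := hasDerivAt_polar_radial r θ
  have hlap := fderiv_fderiv_radial_add_angular u ((r : ℂ) * Complex.exp (θ * Complex.I))
  rw [norm_polar hr.le] at hlap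
  have he : Complex.exp (θ * Complex.I) = r⁻¹ • ((r : ℂ) * Complex.exp (θ * Complex.I)) := by
    rw [Complex.real_smul, ← mul_assoc, ← Complex.ofReal_mul, inv_mul_cancel₀ hr.ne',
      Complex.ofReal_one, one_mul]
  have hu' := (hu.differentiableAt two_ne_zero).hasFDerivAt
  have hA := hasFDerivAt_fderiv_apply hu (ContinuousLinearMap.id ℝ ℂ)
  have hB := hasFDerivAt_fderiv_apply hu (ContinuousLinearMap.mul ℝ ℂ Complex.I)
  have hsymm := hu.isSymmSndFDerivAt (by simp)
  simp only [ContinuousLinearMap.id_apply, ContinuousLinearMap.mul_apply'] at hA hB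
  have hG : HasFDerivAt (pohFlux u) _ _ := (hA.mul hB).add hB
  have hd := ((((hA.comp_hasDerivAt r hγ).pow 2).sub ((hB.comp_hasDerivAt r hγ).pow 2)).add
    ((hA.comp_hasDerivAt r hγ).const_mul 2)).add (((hasDerivAt_id r).pow 2).mul
      ((hK.hasFDerivAt.comp_hasDerivAt r hγ).mul
        ((hu'.comp_hasDerivAt r hγ).const_mul 2).exp))
  refine hd.congr_deriv ?_
  rw [angularDeriv, hG.fderiv]
  set z := (r : ℂ) * Complex.exp (θ * Complex.I) with hz
  have hs := hsymm z (Complex.I * z)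
  have hII : Complex.I * (Complex.I * z) = -z := by
    rw [← mul_assoc, Complex.I_mul_I, neg_one_mul]
  simp only [Pi.mul_apply, Pi.pow_apply, Function.comp_apply, id, ← hz]
  rw [he]
  simp only [add_apply, smul_apply,
    ContinuousLinearMap.comp_apply, ContinuousLinearMap.flip_apply, ContinuousLinearMap.id_apply,
    ContinuousLinearMap.mul_apply', map_smul, smul_eq_mul, hII, map_neg, hs]
  have hlap' : fderiv ℝ (fderiv ℝ u) z z z = -r ^ 2 * (K z * Real.exp (2 * u z)) -
      fderiv ℝ (fderiv ℝ u) z (Complex.I * z) (Complex.I * z) := by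
    rw [← heq]; linarith
  rw [hlap']
  field_simp
  ring

theorem pohP_eq_integral {U : Set ℂ} (hU : IsOpen U) {u K : ℂ → ℝ} (hu : ContDiffOn ℝ 2 u U)
    (hK : ContinuousOn K U) {r : ℝ} (hr : 0 < r)
    (hrU : ∀ θ : ℝ, (r : ℂ) * Complex.exp (θ * Complex.I) ∈ U) :
    pohP u K r = ∫ θ in (0:ℝ)..(2 * Real.pi),
      pohDensity u K r ((r : ℂ) * Complex.exp (θ * Complex.I)) := by
  have hc : Continuous fun θ : ℝ => (r : ℂ) * Complex.exp (θ * Complex.I) := by fun_prop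
  have hdu := (hu.continuousOn_fderiv_of_isOpen hU (by norm_num)).comp_continuous hc hrU
  have hA := hdu.clm_apply hc
  have hB := hdu.clm_apply (continuous_const (y := Complex.I).mul hc)
  have hW := (hK.comp_continuous hc hrU).mul
    ((continuous_const (y := (2:ℝ))).mul (hu.continuousOn.comp_continuous hc hrU)).rexp
  simp only [pohP, circleIntegral', radialDeriv, angularDeriv, pohDensity, norm_polar hr.le,
    map_smul, smul_eq_mul]
  rw [intervalIntegral.integral_add, intervalIntegral.integral_add]
  · simp only [← intervalIntegral.integral_const_mul]
    refine congrArg₂ (· + ·) (congrArg₂ (· + ·) ?_ ?_) ?_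
    all_goals
      refine intervalIntegral.integral_congr fun θ _ => ?_
      field_simp
  all_goals
    refine Continuous.intervalIntegrable ?_ _ _
  · exact (hA.pow 2).sub (hB.pow 2)
  · exact hA.const_mul 2
  · exact ((hA.pow 2).sub (hB.pow 2)).add (hA.const_mul 2)
  · exact hW.const_mul (r ^ 2)

/-- Pohozaev identity on an annulus.  If `-Δu = K e^{2u}` on
`D \ D̄_δ` with `K` of class `C¹` and `u` of class `C²` there, then for all
`δ < s < t < 1`, `P(t) - P(s) = ∫_{D_t \ D_s} r e^{2u} ∂K/∂r dx`
(note `r ∂K/∂r (z) = (fderiv K z) z`). -/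
theorem pohozaev_annulus (δ : ℝ) (hδ0 : 0 < δ) (hδ1 : δ < 1) (u K : ℂ → ℝ)
    (hK : ContDiffOn ℝ 1 K (Metric.ball 0 1 \ Metric.closedBall 0 δ))
    (hu : ContDiffOn ℝ 2 u (Metric.ball 0 1 \ Metric.closedBall 0 δ))
    (heq : ∀ z ∈ Metric.ball (0:ℂ) 1 \ Metric.closedBall (0:ℂ) δ,
      -lapC u z = K z * Real.exp (2 * u z)) :
    ∀ s t : ℝ, δ < s → s < t → t < 1 →
      pohP u K t - pohP u K s =
        ∫ z in Metric.ball (0:ℂ) t \ Metric.closedBall (0:ℂ) s,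
          Real.exp (2 * u z) * fderiv ℝ K z z := by
  intro s t hδs hst ht1
  have hU : IsOpen (Metric.ball (0:ℂ) 1 \ Metric.closedBall (0:ℂ) δ) :=
    Metric.isOpen_ball.sdiff Metric.isClosed_closedBall
  set U := Metric.ball (0:ℂ) 1 \ Metric.closedBall (0:ℂ) δ with hUdef
  have hs0 : 0 < s := hδ0.trans hδs
  have hmemU : ∀ z : ℂ, ‖z‖ ∈ Set.Icc s t → z ∈ U := fun z hz =>
    ⟨mem_ball_zero_iff.2 (hz.2.trans_lt ht1), fun h =>
      (hδs.trans_le hz.1).not_ge (mem_closedBall_zero_iff.1 h)⟩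
  have hpol : ∀ r ∈ Set.Icc s t, ∀ θ : ℝ, (r : ℂ) * Complex.exp (θ * Complex.I) ∈ U :=
    fun r hr θ => hmemU _ (by rwa [norm_polar (hs0.le.trans hr.1)])
  set H : ℂ → ℝ := fun z => Real.exp (2 * u z) * fderiv ℝ K z z with hHdef
  have hH : ContinuousOn H U :=
    (hu.continuousOn.const_mul 2).rexp.mul
      ((hK.continuousOn_fderiv_of_isOpen hU le_rfl).clm_apply continuousOn_id)
  have hG := contDiffOn_pohFlux hU hu
  have hG' : ContinuousOn (angularDeriv (pohFlux u)) U :=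
    (hG.continuousOn_fderiv_of_isOpen hU le_rfl).clm_apply (continuousOn_const.mul continuousOn_id)
  set φ : ℝ → ℝ → ℝ := fun θ r => r * H ((r : ℂ) * Complex.exp (θ * Complex.I)) -
    2 / r * angularDeriv (pohFlux u) ((r : ℂ) * Complex.exp (θ * Complex.I)) with hφdef
  have hφ : ContinuousOn φ.uncurry (Set.Icc 0 (2 * Real.pi) ×ˢ Set.Icc s t) := by
    have hm : Set.MapsTo (fun p : ℝ × ℝ => (p.2 : ℂ) * Complex.exp (p.1 * Complex.I))
      (Set.Icc 0 (2 * Real.pi) ×ˢ Set.Icc s t) U := fun p hp => hpol p.2 hp.2 p.1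
    have hc : ContinuousOn (fun p : ℝ × ℝ => (p.2 : ℂ) * Complex.exp (p.1 * Complex.I))
      (Set.Icc 0 (2 * Real.pi) ×ˢ Set.Icc s t) := by fun_prop
    exact (continuousOn_snd.mul (hH.comp hc hm)).sub
      ((continuousOn_const.div continuousOn_snd fun p hp => (hs0.trans_le hp.2.1).ne').mul
        (hG'.comp hc hm))
  have hftc : ∀ θ ∈ Set.Icc 0 (2 * Real.pi), ∫ r in s..t, φ θ r =
      pohDensity u K t ((t : ℂ) * Complex.exp (θ * Complex.I)) -
        pohDensity u K s ((s : ℂ) * Complex.exp (θ * Complex.I)) := by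
    intro θ hθ
    refine intervalIntegral.integral_eq_sub_of_hasDerivAt
      (f := fun r : ℝ => pohDensity u K r ((r : ℂ) * Complex.exp (θ * Complex.I))) ?_ ?_
    · intro r hr
      rw [Set.uIcc_of_le hst.le] at hr
      have hz := hpol r hr θ
      exact hasDerivAt_pohDensity (hs0.trans_le hr.1) (hu.contDiffAt (hU.mem_nhds hz))
        ((hK.differentiableOn one_ne_zero).differentiableAt (hU.mem_nhds hz)) (heq _ hz)
    · refine ContinuousOn.intervalIntegrable ?_
      rw [Set.uIcc_of_le hst.le]
      exact hφ.comp (f := fun r => (θ, r)) (by fun_prop) fun r hr => ⟨hθ, hr⟩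
  have h2pi : (0:ℝ) ≤ 2 * Real.pi := by positivity
  have hdens : ∀ r ∈ Set.Icc s t, IntervalIntegrable
      (fun θ : ℝ => pohDensity u K r ((r : ℂ) * Complex.exp (θ * Complex.I)))
      volume 0 (2 * Real.pi) := by
    intro r hr
    have hdu := hu.continuousOn_fderiv_of_isOpen hU (by norm_num)
    have hcU : ContinuousOn (pohDensity u K r) U :=
      ((((hdu.clm_apply continuousOn_id).pow 2).sub
        ((hdu.clm_apply (continuousOn_const.mul continuousOn_id)).pow 2)).add
          ((hdu.clm_apply continuousOn_id).const_mul 2)).add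
        ((hK.continuousOn.mul (hu.continuousOn.const_mul 2).rexp).const_mul (r ^ 2))
    exact (hcU.comp_continuous (by fun_prop) (hpol r hr)).intervalIntegrable _ _
  have hsI : s ∈ Set.Icc s t := ⟨le_rfl, hst.le⟩
  have htI : t ∈ Set.Icc s t := ⟨hst.le, le_rfl⟩
  rw [setIntegral_annulus_eq hs0.le hst.le (hH.mono hmemU),
    pohP_eq_integral hU hu hK.continuousOn (hs0.trans hst) (hpol t htI),
    pohP_eq_integral hU hu hK.continuousOn hs0 (hpol s hsI),
    ← intervalIntegral.integral_sub (hdens t htI) (hdens s hsI)]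
  calc _ = ∫ θ in (0:ℝ)..(2 * Real.pi), ∫ r in s..t, φ θ r := by
        refine intervalIntegral.integral_congr fun θ hθ => (hftc θ ?_).symm
        rwa [Set.uIcc_of_le h2pi] at hθ
    _ = ∫ r in s..t, ∫ θ in (0:ℝ)..(2 * Real.pi), φ θ r := by
        refine intervalIntegral_intervalIntegral_swap ?_
        rw [Set.uIoc_of_le h2pi, Set.uIoc_of_le hst.le]
        exact (hφ.integrableOn_compact (isCompact_Icc.prod isCompact_Icc)).mono_set
          (Set.prod_mono Set.Ioc_subset_Icc_self Set.Ioc_subset_Icc_self)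
    _ = _ := by
        refine intervalIntegral.integral_congr fun r hr => ?_
        rw [Set.uIcc_of_le hst.le] at hr
        have hc : Continuous fun θ : ℝ => (r : ℂ) * Complex.exp (θ * Complex.I) := by fun_prop
        simp only [hφdef]
        rw [intervalIntegral.integral_sub, intervalIntegral.integral_const_mul,
          intervalIntegral.integral_const_mul, integral_angularDeriv_eq_zero hU hG (hpol r hr),
          mul_zero, sub_zero]
        · exact ((hH.comp_continuous hc (hpol r hr)).const_mul r).intervalIntegrable _ _
        · exact ((hG'.comp_continuous hc (hpol r hr)).const_mul (2 / r)).intervalIntegrable _ _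

end
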